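/- There is a constant C > 0 such that for every ω ≥ 1 and every Schwartz function f on ℝ³ = ℝ² × ℝ (variables (x,z)), the function P₀f defined by (P₀f)(x,z) = (∫_ℝ f(x,z') h_ω(z') dz') · h_ω(z) satisfies ‖P₀f‖_{L^∞(ℝ³)} ≤ C ω^{1/4} ‖S²f‖_{L²(ℝ³)}, where S²f = (1−ω) f − Δ f + ω² z² f. -/

import Mathlib

open MeasureTheory Complex

noncomputable section

/-- ℝ² with the Euclidean norm. -/
abbrev R2 : Type := EuclideanSpace ℝ (Fin 2)

/-- ℝ³ written as ℝ² × ℝ, points r = (x, z). -/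
abbrev R3 : Type := R2 × ℝ

/-- Directional derivative of `f` at `p` in the direction `v`. -/
def pd {E F : Type*} [NormedAddCommGroup E] [NormedSpace ℝ E]
    [NormedAddCommGroup F] [NormedSpace ℝ F] (v : E) (f : E → F) (p : E) : F :=
  fderiv ℝ f p v

/-- Second directional derivative in the direction `v`. -/
def pd2 {E F : Type*} [NormedAddCommGroup E] [NormedSpace ℝ E]
    [NormedAddCommGroup F] [NormedSpace ℝ F] (v : E) (f : E → F) (p : E) : F :=
  pd v (pd v f) p

/-- First coordinate direction in the x-plane. -/
def ex0 : R3 := (EuclideanSpace.single 0 1, 0)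

/-- Second coordinate direction in the x-plane. -/
def ex1 : R3 := (EuclideanSpace.single 1 1, 0)

/-- The z-direction. -/
def ez : R3 := (0, 1)

/-- The full Laplacian on ℝ³ = ℝ² × ℝ. -/
def lap3 {F : Type*} [NormedAddCommGroup F] [NormedSpace ℝ F]
    (f : R3 → F) (p : R3) : F :=
  pd2 ex0 f p + pd2 ex1 f p + pd2 ez f p

/-- The operator `S² f = (1−ω)f − Δf + ω² z² f` on functions on ℝ³. -/
def S2op (ω : ℝ) (f : R3 → ℂ) (p : R3) : ℂ :=
  ((1 - ω : ℝ) : ℂ) * f p - lap3 f p + ((ω ^ 2 * p.2 ^ 2 : ℝ) : ℂ) * f p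
/-- Normalized ground state `h_ω(z) = ω^{1/4} π^{-1/4} e^{-ωz²/2}` of `−∂_z² + ω²z²`. -/
def hosc (ω z : ℝ) : ℝ :=
  ω ^ ((1 : ℝ) / 4) * Real.pi ^ (-(1 : ℝ) / 4) * Real.exp (-(ω * z ^ 2) / 2)

/-- Orthogonal projection (in the z-variable) onto the span of `h_ω`:
`(P₀f)(x,z) = (∫ f(x,zᐟ) h_ω(zᐟ) dzᐟ) h_ω(z)`. -/
def P0 (ω : ℝ) (f : R3 → ℂ) (p : R3) : ℂ :=
  (∫ zp : ℝ, f (p.1, zp) * (hosc ω zp : ℂ)) * (hosc ω p.2 : ℂ)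

open scoped SchwartzMap LineDeriv

section Marginal

variable {E V : Type} [NormedAddCommGroup E] [NormedSpace ℝ E]
  [NormedAddCommGroup V] [NormedSpace ℝ V] {h : ℝ → ℝ}

theorem integrable_smul_section (hh : Integrable h) (f : 𝓢(E × ℝ, V)) (x : E) :
    Integrable fun z : ℝ => h z • f (x, z) := by
  have hf : Continuous fun z : ℝ => f (x, z) := f.continuous.comp (by fun_prop)
  refine (hh.norm.mul_const (SchwartzMap.seminorm ℝ 0 0 f)).mono'
    (hh.aestronglyMeasurable.smul hf.aestronglyMeasurable) (.of_forall fun z => ?_)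
  rw [norm_smul]
  gcongr
  exact f.norm_le_seminorm ℝ _

/-- The derivative of a Schwartz function on `E × ℝ` in the directions of `E`. -/
def fderivFst (f : 𝓢(E × ℝ, V)) : 𝓢(E × ℝ, E →L[ℝ] V) :=
  SchwartzMap.postcompCLM ((ContinuousLinearMap.compL ℝ E (E × ℝ) V).flip
    (ContinuousLinearMap.inl ℝ E ℝ)) (SchwartzMap.fderivCLM ℝ (E × ℝ) V f)

theorem fderivFst_apply (f : 𝓢(E × ℝ, V)) (p : E × ℝ) :
    fderivFst f p = (fderiv ℝ f p).comp (ContinuousLinearMap.inl ℝ E ℝ) := by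
  simp [fderivFst]

theorem hasFDerivAt_integral_smul_section (hh : Integrable h) (f : 𝓢(E × ℝ, V)) (x : E) :
    HasFDerivAt (fun x => ∫ z : ℝ, h z • f (x, z)) (∫ z : ℝ, h z • fderivFst f (x, z)) x := by
  refine hasFDerivAt_integral_of_dominated_of_fderiv_le
    (F := fun x z => h z • f (x, z)) (F' := fun x z => h z • fderivFst f (x, z))
    (bound := fun z => ‖h z‖ * SchwartzMap.seminorm ℝ 0 0 (fderivFst f)) Filter.univ_mem
    (.of_forall fun y => (integrable_smul_section hh f y).aestronglyMeasurable)
    (integrable_smul_section hh f x)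
    (integrable_smul_section hh (fderivFst f) x).aestronglyMeasurable
    (.of_forall fun z y _ => ?_) (hh.norm.mul_const _) (.of_forall fun z y _ => ?_)
  · rw [norm_smul]
    gcongr
    exact (fderivFst f).norm_le_seminorm ℝ _
  · rw [fderivFst_apply]
    exact ((f.hasFDerivAt (y, z)).comp y (hasFDerivAt_prodMk_left y z)).const_smul (h z)

theorem fderiv_integral_smul_section (hh : Integrable h) (f : 𝓢(E × ℝ, V)) :
    fderiv ℝ (fun x => ∫ z : ℝ, h z • f (x, z)) = fun x => ∫ z : ℝ, h z • fderivFst f (x, z) :=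
  funext fun x => (hasFDerivAt_integral_smul_section hh f x).fderiv

theorem contDiff_integral_smul_section (hh : Integrable h) (n : ℕ) :
    ∀ {V : Type} [NormedAddCommGroup V] [NormedSpace ℝ V] (f : 𝓢(E × ℝ, V)),
      ContDiff ℝ n fun x => ∫ z : ℝ, h z • f (x, z) := by
  induction n with
  | zero =>
    intro V _ _ f
    exact contDiff_zero.2 (Differentiable.continuous
      fun x => (hasFDerivAt_integral_smul_section hh f x).differentiableAt)
  | succ n ih =>
    intro V _ _ f
    rw [Nat.cast_succ]
    refine contDiff_succ_iff_fderiv.2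
      ⟨fun x => (hasFDerivAt_integral_smul_section hh f x).differentiableAt,
        fun h => absurd h (WithTop.natCast_ne_top n), ?_⟩
    rw [fderiv_integral_smul_section hh]
    exact ih _

theorem decay_integral_smul_section (hh : Integrable h) (k n : ℕ) :
    ∀ {V : Type} [NormedAddCommGroup V] [NormedSpace ℝ V] (f : 𝓢(E × ℝ, V)),
      ∃ C : ℝ, ∀ x, ‖x‖ ^ k *
        ‖iteratedFDeriv ℝ n (fun x => ∫ z : ℝ, h z • f (x, z)) x‖ ≤ C := by
  induction n with
  | zero =>
    intro V _ _ f
    refine ⟨∫ z, ‖h z‖ * SchwartzMap.seminorm ℝ k 0 f, fun x => ?_⟩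
    rw [norm_iteratedFDeriv_zero, ← norm_norm, ← norm_pow, ← norm_smul, ← integral_smul]
    refine norm_integral_le_of_norm_le (hh.norm.mul_const _) (.of_forall fun z => ?_)
    rw [norm_smul, norm_smul, mul_left_comm, norm_pow, norm_norm]
    gcongr
    refine le_trans ?_ (f.norm_pow_mul_le_seminorm ℝ k (x, z))
    gcongr
    exact norm_fst_le (x, z)
  | succ n ih =>
    intro V _ _ f
    obtain ⟨C, hC⟩ := ih (fderivFst f)
    refine ⟨C, fun x => ?_⟩
    rw [← norm_iteratedFDeriv_fderiv, fderiv_integral_smul_section hh]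
    exact hC x

/-- The weighted partial integral `x ↦ ∫ h(z) f(x, z) dz` of a Schwartz function `f`. -/
def weightedMarginal (hh : Integrable h) (f : 𝓢(E × ℝ, V)) : 𝓢(E, V) where
  toFun x := ∫ z : ℝ, h z • f (x, z)
  smooth' := contDiff_infty.2 fun n => contDiff_integral_smul_section hh n f
  decay' k n := decay_integral_smul_section hh k n f

theorem weightedMarginal_apply (hh : Integrable h) (f : 𝓢(E × ℝ, V)) (x : E) :
    weightedMarginal hh f x = ∫ z : ℝ, h z • f (x, z) := rfl

theorem weightedMarginal_sub (hh : Integrable h) (f g : 𝓢(E × ℝ, V)) :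
    weightedMarginal hh (f - g) = weightedMarginal hh f - weightedMarginal hh g := by
  ext x
  simp only [weightedMarginal_apply, sub_apply, smul_sub]
  exact integral_sub (integrable_smul_section hh f x) (integrable_smul_section hh g x)

theorem weightedMarginal_add (hh : Integrable h) (f g : 𝓢(E × ℝ, V)) :
    weightedMarginal hh (f + g) = weightedMarginal hh f + weightedMarginal hh g := by
  ext x
  simp only [weightedMarginal_apply, add_apply, smul_add]
  exact integral_add (integrable_smul_section hh f x) (integrable_smul_section hh g x)

theorem lineDerivOp_weightedMarginal [CompleteSpace V] (hh : Integrable h) (m : E)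
    (f : 𝓢(E × ℝ, V)) :
    ∂_{m} (weightedMarginal hh f) = weightedMarginal hh (∂_{((m, 0) : E × ℝ)} f) := by
  ext x
  rw [SchwartzMap.lineDerivOp_apply_eq_fderiv]
  change fderiv ℝ (fun x => ∫ z : ℝ, h z • f (x, z)) x m = _
  rw [fderiv_integral_smul_section hh]
  dsimp only
  rw [ContinuousLinearMap.integral_apply (integrable_smul_section hh _ x)]
  simp [weightedMarginal_apply, fderivFst_apply, SchwartzMap.lineDerivOp_apply_eq_fderiv]

end Marginal

theorem integral_norm_mul_norm_le_sqrt {α E F : Type*} [MeasurableSpace α] {μ : Measure α}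
    [NormedAddCommGroup E] [NormedAddCommGroup F] {f : α → E} {g : α → F}
    (hf : MemLp f 2 μ) (hg : MemLp g 2 μ) :
    ∫ a, ‖f a‖ * ‖g a‖ ∂μ ≤ √(∫ a, ‖f a‖ ^ 2 ∂μ) * √(∫ a, ‖g a‖ ^ 2 ∂μ) := by
  have := integral_mul_norm_le_Lp_mul_Lq (μ := μ) (f := fun a => ‖f a‖) (g := fun a => ‖g a‖)
    Real.HolderConjugate.two_two (by simpa using hf.norm) (by simpa using hg.norm)
  simpa [Real.sqrt_eq_rpow] using this

open scoped FourierTransform Laplacian in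
theorem fourier_sub_laplacian_apply {E : Type*} [NormedAddCommGroup E] [InnerProductSpace ℝ E]
    [FiniteDimensional ℝ E] [MeasurableSpace E] [BorelSpace E] (g : 𝓢(E, ℂ)) (ξ : E) :
    𝓕 (g - Δ g) ξ = ((1 + (2 * Real.pi) ^ 2 * ‖ξ‖ ^ 2 : ℝ) : ℂ) * 𝓕 g ξ := by
  have hn : Function.HasTemperateGrowth fun x : E => ‖x‖ ^ 2 := by fun_prop
  have h1 : 𝓕 (Δ g) =
      -(2 * Real.pi) ^ 2 • SchwartzMap.smulLeftCLM ℂ (fun x : E => ‖x‖ ^ 2) (𝓕 g) := by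
    rw [SchwartzMap.laplacian_eq_fourierMultiplierCLM, FourierTransform.fourier_smul,
      SchwartzMap.fourierMultiplierCLM_apply, FourierTransform.fourier_fourierInv_eq]
  have h2 : 𝓕 (g - Δ g) = 𝓕 g - 𝓕 (Δ g) :=
    map_sub (FourierTransform.fourierCLM ℂ 𝓢(E, ℂ)) g (Δ g)
  rw [h2, h1]
  simp [SchwartzMap.smulLeftCLM_apply_apply hn]
  ring

open scoped FourierTransform Laplacian in
theorem exists_norm_le_integral_norm_sq_sub_laplacian :
    ∃ C : ℝ, 0 < C ∧ ∀ (g : 𝓢(R2, ℂ)) (x : R2), ‖g x‖ ≤ C * √(∫ y, ‖(g - Δ g) y‖ ^ 2) := by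
  let w : R2 → ℝ := fun ξ => (1 + ‖ξ‖ ^ 2)⁻¹
  have hwc : Continuous w :=
    Continuous.inv₀ (by fun_prop) fun ξ => by positivity
  have hw : MemLp w 2 := by
    refine (memLp_two_iff_integrable_sq hwc.aestronglyMeasurable).2 ?_
    have := integrable_rpow_neg_one_add_norm_sq (E := R2) (μ := volume) (r := 4) (by simp; norm_num)
    refine this.congr (.of_forall fun ξ => ?_)
    simp only [w]
    rw [show (-4 / 2 : ℝ) = ((-2 : ℤ) : ℝ) by norm_num, Real.rpow_intCast]
    simp [zpow_neg, inv_pow]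
  refine ⟨√(∫ ξ, ‖w ξ‖ ^ 2) + 1, by positivity, fun g x => ?_⟩
  have hle : ∀ ξ, ‖𝓕 g ξ‖ ≤ ‖w ξ‖ * ‖𝓕 (g - Δ g) ξ‖ := fun ξ => by
    rw [fourier_sub_laplacian_apply, norm_mul, Complex.norm_real,
      Real.norm_of_nonneg (by positivity), Real.norm_of_nonneg (by positivity), ← mul_assoc]
    refine le_mul_of_one_le_left (norm_nonneg _) ?_
    rw [inv_mul_eq_div, one_le_div (by positivity)]
    gcongr
    refine le_mul_of_one_le_left (by positivity) ?_
    nlinarith [Real.pi_gt_three]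
  have hF : MemLp (fun ξ => 𝓕 (g - Δ g) ξ) 2 volume := (𝓕 (g - Δ g) : 𝓢(R2, ℂ)).memLp 2
  calc ‖g x‖ = ‖𝓕⁻ (𝓕 g) x‖ := by rw [FourierTransform.fourierInv_fourier_eq]
    _ ≤ ∫ ξ, ‖𝓕 g ξ‖ := by
      rw [SchwartzMap.fourierInv_coe, Real.fourierInv_eq]
      refine (norm_integral_le_integral_norm _).trans_eq ?_
      simp
    _ ≤ ∫ ξ, ‖w ξ‖ * ‖𝓕 (g - Δ g) ξ‖ :=
      integral_mono (𝓕 g).integrable.norm (hw.norm.integrable_mul hF.norm) hle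
    _ ≤ √(∫ ξ, ‖w ξ‖ ^ 2) * √(∫ ξ, ‖𝓕 (g - Δ g) ξ‖ ^ 2) :=
      integral_norm_mul_norm_le_sqrt hw hF
    _ ≤ _ := by
      rw [SchwartzMap.integral_norm_sq_fourier]
      gcongr
      linarith

section GroundState

theorem hosc_nonneg {ω : ℝ} (hω : 0 < ω) (z : ℝ) : 0 ≤ hosc ω z := by
  unfold hosc
  positivity

theorem hosc_sq {ω : ℝ} (hω : 0 < ω) (z : ℝ) :
    hosc ω z ^ 2 = (√(Real.pi / ω))⁻¹ * Real.exp (-ω * z ^ 2) := by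
  have h1 : (ω ^ ((1 : ℝ) / 4)) ^ 2 = √ω := by
    rw [← Real.rpow_natCast, ← Real.rpow_mul hω.le, Real.sqrt_eq_rpow]
    norm_num
  have h2 : (Real.pi ^ (-(1 : ℝ) / 4)) ^ 2 = (√Real.pi)⁻¹ := by
    rw [← Real.rpow_natCast, ← Real.rpow_mul Real.pi_pos.le, Real.sqrt_eq_rpow,
      ← Real.rpow_neg Real.pi_pos.le]
    norm_num
  have h3 : Real.exp (-(ω * z ^ 2) / 2) ^ 2 = Real.exp (-ω * z ^ 2) := by
    rw [← Real.exp_nat_mul]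
    congr 1
    push_cast
    ring
  rw [hosc, mul_pow, mul_pow, h1, h2, h3, Real.sqrt_div Real.pi_pos.le, inv_div]
  ring

theorem integrable_hosc {ω : ℝ} (hω : 0 < ω) : Integrable (hosc ω) := by
  refine ((integrable_exp_neg_mul_sq (half_pos hω)).const_mul
    (ω ^ ((1 : ℝ) / 4) * Real.pi ^ (-(1 : ℝ) / 4))).congr (.of_forall fun z => ?_)
  simp only [hosc]
  ring_nf

theorem integral_hosc_sq {ω : ℝ} (hω : 0 < ω) : ∫ z, hosc ω z ^ 2 = 1 := by
  simp_rw [hosc_sq hω]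
  rw [integral_const_mul, integral_gaussian]
  exact inv_mul_cancel₀ (by positivity)

theorem memLp_hosc {ω : ℝ} (hω : 0 < ω) : MemLp (hosc ω) 2 := by
  refine (memLp_two_iff_integrable_sq (integrable_hosc hω).aestronglyMeasurable).2 ?_
  simp_rw [hosc_sq hω]
  exact (integrable_exp_neg_mul_sq hω).const_mul _

theorem hosc_le {ω : ℝ} (hω : 0 < ω) (z : ℝ) : hosc ω z ≤ ω ^ ((1 : ℝ) / 4) := by
  have h1 : Real.pi ^ (-(1 : ℝ) / 4) ≤ 1 :=
    Real.rpow_le_one_of_one_le_of_nonpos (by linarith [Real.pi_gt_three]) (by norm_num)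
  have h2 : Real.exp (-(ω * z ^ 2) / 2) ≤ 1 := by
    rw [Real.exp_le_one_iff]
    have : 0 ≤ ω * z ^ 2 := by positivity
    linarith
  calc hosc ω z ≤ ω ^ ((1 : ℝ) / 4) * 1 * 1 := by
        unfold hosc
        gcongr
    _ = _ := by ring

theorem hasDerivAt_hosc (ω z : ℝ) : HasDerivAt (hosc ω) (-(ω * z) * hosc ω z) z := by
  have h : HasDerivAt (fun z : ℝ => -(ω * z ^ 2) / 2) (-(ω * z)) z := by
    refine (((hasDerivAt_pow 2 z).const_mul ω).neg.div_const 2).congr_deriv ?_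
    push_cast
    ring
  refine (h.exp.const_mul (ω ^ ((1 : ℝ) / 4) * Real.pi ^ (-(1 : ℝ) / 4))).congr_deriv ?_
  unfold hosc
  ring

end GroundState

section Vertical

/-- Multiplication of a Schwartz function on `ℝ² × ℝ` by the coordinate `z`. -/
def mulZ (f : 𝓢(R3, ℂ)) : 𝓢(R3, ℂ) :=
  SchwartzMap.smulLeftCLM ℂ (fun p : R3 => p.2) f

theorem mulZ_apply (f : 𝓢(R3, ℂ)) (p : R3) : mulZ f p = (p.2 : ℂ) * f p := by
  have h : Function.HasTemperateGrowth fun p : R3 => p.2 :=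
    (ContinuousLinearMap.snd ℝ R2 ℝ).hasTemperateGrowth
  simp [mulZ, SchwartzMap.smulLeftCLM_apply_apply h]

theorem lineDerivOp_ez_mulZ_apply (f : 𝓢(R3, ℂ)) (p : R3) :
    (∂_{ez} (mulZ f)) p = f p + (p.2 : ℂ) * (∂_{ez} f) p := by
  have h1 : HasFDerivAt (fun q : R3 => q.2) (ContinuousLinearMap.snd ℝ R2 ℝ) p :=
    (ContinuousLinearMap.snd ℝ R2 ℝ).hasFDerivAt
  have h2 : HasFDerivAt (mulZ f) _ p := (h1.smul (f.hasFDerivAt p)).congr_of_eventuallyEq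
    (.of_forall fun q => by simp [mulZ_apply])
  rw [SchwartzMap.lineDerivOp_apply_eq_fderiv, SchwartzMap.lineDerivOp_apply_eq_fderiv, h2.fderiv]
  simp [ez]
  ring

/-- The creation operator is annihilated by integration against the ground state. -/
theorem weightedMarginal_hosc_creation {ω : ℝ} (hω : 0 < ω) (f : 𝓢(R3, ℂ)) :
    weightedMarginal (integrable_hosc hω) (∂_{ez} f - ω • mulZ f) = 0 := by
  ext x
  rw [weightedMarginal_apply]
  refine integral_eq_zero_of_hasDerivAt_of_integrable (f := fun z => hosc ω z • f (x, z))
    (fun z => ?_) (integrable_smul_section (integrable_hosc hω) _ x)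
    (integrable_smul_section (integrable_hosc hω) f x)
  have h1 : HasDerivAt (fun z : ℝ => f (x, z)) ((∂_{ez} f) (x, z)) z := by
    rw [SchwartzMap.lineDerivOp_apply_eq_fderiv]
    exact (f.hasFDerivAt (x, z)).comp_hasDerivAt z
      ((hasDerivAt_const z x).prodMk (hasDerivAt_id z))
  refine ((hasDerivAt_hosc ω z).smul h1).congr_deriv ?_
  simp only [sub_apply, smul_apply, mulZ_apply, Complex.real_smul]
  push_cast
  ring

end Vertical

section Reduction

instance : (volume : Measure R3).IsAddHaarMeasure :=
  inferInstanceAs ((volume : Measure R2).prod (volume : Measure ℝ)).IsAddHaarMeasure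

open scoped Laplacian

theorem S2op_eq_schwartz (ω : ℝ) (f : 𝓢(R3, ℂ)) :
    S2op ω f = ⇑(f - (∂_{ex0} (∂_{ex0} f) + ∂_{ex1} (∂_{ex1} f)) -
      (∂_{ez} (∂_{ez} f + ω • mulZ f) - ω • mulZ (∂_{ez} f + ω • mulZ f))) := by
  ext p
  have h : ∀ v : R3, pd2 v f p = (∂_{v} (∂_{v} f)) p := fun v => rfl
  simp only [S2op, lap3, h, sub_apply, add_apply, smul_apply,
    LineDeriv.lineDerivOp_add, LineDeriv.lineDerivOp_smul, mulZ_apply,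
    lineDerivOp_ez_mulZ_apply, Complex.real_smul]
  push_cast
  ring

theorem weightedMarginal_planar_laplacian {h : ℝ → ℝ} (hh : Integrable h) (f : 𝓢(R3, ℂ)) :
    weightedMarginal hh (∂_{ex0} (∂_{ex0} f) + ∂_{ex1} (∂_{ex1} f)) =
      Δ (weightedMarginal hh f) := by
  rw [SchwartzMap.laplacian_eq_sum (EuclideanSpace.basisFun (Fin 2) ℝ), Fin.sum_univ_two]
  simp only [lineDerivOp_weightedMarginal, EuclideanSpace.basisFun_apply, weightedMarginal_add]
  rfl

theorem integral_norm_sq_weightedMarginal_hosc_le {ω : ℝ} (hω : 0 < ω) (f : 𝓢(R3, ℂ)) :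
    ∫ x, ‖weightedMarginal (integrable_hosc hω) f x‖ ^ 2 ≤ ∫ p, ‖f p‖ ^ 2 := by
  have hf2 : Integrable fun p : R3 => ‖f p‖ ^ 2 := (f.memLp 2).integrable_norm_pow two_ne_zero
  have hg2 : Integrable fun x => ‖weightedMarginal (integrable_hosc hω) f x‖ ^ 2 :=
    ((weightedMarginal (integrable_hosc hω) f).memLp 2).integrable_norm_pow two_ne_zero
  rw [Measure.volume_eq_prod] at hf2 ⊢
  rw [integral_prod _ hf2]
  refine integral_mono_ae hg2 hf2.integral_prod_left ?_
  filter_upwards [hf2.prod_right_ae] with x hx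
  have hfx : MemLp (fun z => f (x, z)) 2 :=
    (memLp_two_iff_integrable_sq_norm
      (f.continuous.comp (Continuous.prodMk_right x)).aestronglyMeasurable).2 hx
  have key : ‖weightedMarginal (integrable_hosc hω) f x‖ ≤ √(∫ z, ‖f (x, z)‖ ^ 2) := by
    calc ‖weightedMarginal (integrable_hosc hω) f x‖
        ≤ ∫ z, ‖hosc ω z‖ * ‖f (x, z)‖ := by
          rw [weightedMarginal_apply]
          simpa only [norm_smul] using
            norm_integral_le_integral_norm fun z => hosc ω z • f (x, z)
      _ ≤ √(∫ z, ‖hosc ω z‖ ^ 2) * √(∫ z, ‖f (x, z)‖ ^ 2) :=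
          integral_norm_mul_norm_le_sqrt (memLp_hosc hω) hfx
      _ = _ := by simp [integral_hosc_sq hω]
  calc _ ≤ √(∫ z, ‖f (x, z)‖ ^ 2) ^ 2 := by gcongr
    _ = _ := Real.sq_sqrt (integral_nonneg fun z => by positivity)

theorem weightedMarginal_hosc_S2op {ω : ℝ} (hω : 0 < ω) {f q : 𝓢(R3, ℂ)}
    (hq : S2op ω f = q) :
    weightedMarginal (integrable_hosc hω) q =
      weightedMarginal (integrable_hosc hω) f - Δ (weightedMarginal (integrable_hosc hω) f) := by
  have h := DFunLike.coe_injective (hq.symm.trans (S2op_eq_schwartz ω f))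
  rw [h, weightedMarginal_sub, weightedMarginal_sub, weightedMarginal_planar_laplacian,
    weightedMarginal_hosc_creation hω, sub_zero]

theorem P0_apply_eq_weightedMarginal {ω : ℝ} (hω : 0 < ω) (f : 𝓢(R3, ℂ)) (p : R3) :
    P0 ω f p = weightedMarginal (integrable_hosc hω) f p.1 * (hosc ω p.2 : ℂ) := by
  simp only [P0, weightedMarginal_apply, Complex.real_smul, mul_comm]

theorem toReal_eLpNorm_two_eq_sqrt (f : 𝓢(R3, ℂ)) :
    (eLpNorm f 2 volume).toReal = √(∫ p, ‖f p‖ ^ 2) := by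
  have hf : MemLp (⇑f) 2 (volume : Measure R3) := f.memLp 2
  have h := hf.eLpNorm_eq_integral_rpow_norm two_ne_zero ENNReal.ofNat_ne_top
  rw [h, ENNReal.toReal_ofReal (by positivity)]
  simp [Real.sqrt_eq_rpow]

end Reduction

/-- there is `C > 0` such that for all `ω ≥ 1` and Schwartz `f` on ℝ³,
`‖P₀f‖_{L^∞} ≤ C ω^{1/4} ‖S²f‖_{L²}`. -/
theorem P0_Linfty_bound :
    ∃ C : ℝ, 0 < C ∧ ∀ ω : ℝ, 1 ≤ ω → ∀ f : SchwartzMap R3 ℂ,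
      (eLpNorm (P0 ω (⇑f)) ⊤ volume).toReal ≤
        C * ω ^ ((1 : ℝ) / 4) * (eLpNorm (S2op ω (⇑f)) 2 volume).toReal := by
  obtain ⟨C, hC, hsob⟩ := exists_norm_le_integral_norm_sq_sub_laplacian
  refine ⟨C, hC, fun ω hω1 f => ?_⟩
  have hω : 0 < ω := by linarith
  obtain ⟨q, hq⟩ : ∃ q : SchwartzMap R3 ℂ, S2op ω f = q := ⟨_, S2op_eq_schwartz ω f⟩
  rw [hq, toReal_eLpNorm_two_eq_sqrt]
  refine ENNReal.toReal_le_of_le_ofReal (by positivity) ?_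
  rw [eLpNorm_exponent_top]
  refine eLpNormEssSup_le_of_ae_bound (.of_forall fun p => ?_)
  rw [P0_apply_eq_weightedMarginal hω, norm_mul, Complex.norm_real,
    Real.norm_of_nonneg (hosc_nonneg hω _), mul_right_comm]
  refine mul_le_mul ((hsob _ _).trans ?_) (hosc_le hω _) (hosc_nonneg hω _) (by positivity)
  rw [← weightedMarginal_hosc_S2op hω hq]
  gcongr
  exact integral_norm_sq_weightedMarginal_hosc_le hω q
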